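/- arXiv:1302.3308 — 2 statements merged into one kernel-verified Lean document; each statement's English description precedes it below -/
import Mathlib

section
/- Let f, g ∈ F[Y ∪ Z]. If g is an affine form, i.e., a polynomial of total degree at most 1, then maxrank(M_{fg}) ≤ 2 · maxrank(M_f). -/
open scoped Classical

noncomputable section

namespace PCM

variable {F : Type} [Field F] {Y Z : Type} [Fintype Y] [Fintype Z]

/-- Exponent vector of the monic multilinear monomial `∏_{y ∈ p} y · ∏_{z ∈ q} z`. -/
def mexp (p : Finset Y) (q : Finset Z) : (Y ⊕ Z) →₀ ℕ :=
  (∑ y ∈ p, Finsupp.single (Sum.inl y) 1) + ∑ z ∈ q, Finsupp.single (Sum.inr z) 1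

/-- The polynomial coefficient matrix `M_f`. -/
def coeffMatrix (f : MvPolynomial (Y ⊕ Z) F) :
    Matrix (Finset Y) (Finset Z) (MvPolynomial (Y ⊕ Z) F) := fun p q =>
  ∑ d ∈ f.support,
    if d.support ⊆ p.image Sum.inl ∪ q.image Sum.inr ∧ mexp p q ≤ d then
      MvPolynomial.monomial (d - mexp p q) (MvPolynomial.coeff d f)
    else 0

/-- `maxrank(M_f)`: the maximum, over substitutions `S`, of the rank of `M_f|_S`. -/
def maxrank (f : MvPolynomial (Y ⊕ Z) F) : ℕ :=
  ⨆ S : (Y ⊕ Z) → F, ((coeffMatrix f).map (MvPolynomial.eval S)).rank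

/-- The partial derivatives matrix `L_f`. -/
def pdMatrix (f : MvPolynomial (Y ⊕ Z) F) : Matrix (Finset Y) (Finset Z) F := fun p q =>
  MvPolynomial.coeff (mexp p q) f

end PCM

namespace PCM

variable {F : Type} [Field F] {Y Z : Type}

/-- The set of variables occurring in the monomials `p` and `q`. -/
def vars (p : Finset Y) (q : Finset Z) : Finset (Y ⊕ Z) :=
  p.image Sum.inl ∪ q.image Sum.inr

lemma vars_erase_inl (p : Finset Y) (q : Finset Z) (y : Y) :
    (vars p q).erase (Sum.inl y) = vars (p.erase y) q := by
  ext i; cases i <;> simp [vars]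

lemma vars_erase_inr (p : Finset Y) (q : Finset Z) (z : Z) :
    (vars p q).erase (Sum.inr z) = vars p (q.erase z) := by
  ext i; cases i <;> simp [vars]

lemma mexp_apply (p : Finset Y) (q : Finset Z) (i : Y ⊕ Z) :
    mexp p q i = if i ∈ vars p q then 1 else 0 := by
  cases i <;> simp [mexp, vars, Finsupp.single_apply]

/-- `M_f` evaluated at `S`. -/
def evalMatrix (S : Y ⊕ Z → F) (f : MvPolynomial (Y ⊕ Z) F) : Matrix (Finset Y) (Finset Z) F :=
  (coeffMatrix f).map (MvPolynomial.eval S)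

lemma rank_evalMatrix_le_maxrank [Fintype Z] (S : Y ⊕ Z → F) (f : MvPolynomial (Y ⊕ Z) F) :
    (evalMatrix S f).rank ≤ maxrank f := by
  refine le_ciSup (f := fun S => (evalMatrix S f).rank) ⟨Fintype.card (Finset Z), ?_⟩ S
  rintro _ ⟨S, rfl⟩
  exact Matrix.rank_le_card_width _

lemma rank_add_le {m n : Type*} [Finite m] [Fintype n] (A B : Matrix m n F) :
    (A + B).rank ≤ A.rank + B.rank := by
  rw [Matrix.rank, Matrix.rank, Matrix.rank, Matrix.mulVecLin_add]
  exact (Submodule.finrank_mono (LinearMap.range_add_le _ _)).trans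
    (Submodule.finrank_add_le_finrank_add_finrank _ _)

variable [Fintype Y] [Fintype Z]

/-- The value at `S` of `x ^ d / ∏ i ∈ T, x i` when `T` is the support of `d`, and `0` otherwise. -/
def weight (S : Y ⊕ Z → F) (T : Finset (Y ⊕ Z)) (d : (Y ⊕ Z) →₀ ℕ) : F :=
  if d.support = T then ∏ i, S i ^ (d i - 1) else 0

/-- The linear functional on polynomials given on monomials by `weight S T`. -/
def weightFunctional (S : Y ⊕ Z → F) (T : Finset (Y ⊕ Z)) : MvPolynomial (Y ⊕ Z) F →ₗ[F] F :=
  (MvPolynomial.basisMonomials (Y ⊕ Z) F).constr F (weight S T)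

lemma weightFunctional_monomial (S : Y ⊕ Z → F) (T : Finset (Y ⊕ Z)) (d : (Y ⊕ Z) →₀ ℕ) (c : F) :
    weightFunctional S T (MvPolynomial.monomial d c) = c * weight S T d := by
  have h : MvPolynomial.monomial d c = c • MvPolynomial.basisMonomials (Y ⊕ Z) F d := by
    simp [MvPolynomial.smul_monomial]
  rw [h, map_smul, weightFunctional, Module.Basis.constr_basis, smul_eq_mul]

lemma weight_add_single (S : Y ⊕ Z → F) (T : Finset (Y ⊕ Z)) (d : (Y ⊕ Z) →₀ ℕ) (v : Y ⊕ Z) :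
    weight S T (d + Finsupp.single v 1) =
      if v ∈ T then S v * weight S T d + weight S (T.erase v) d else 0 := by
  have hs : (d + Finsupp.single v 1 : (Y ⊕ Z) →₀ ℕ).support = insert v d.support := by
    ext i
    by_cases h : v = i <;> simp [h, eq_comm]
  have hprod : ∀ e : (Y ⊕ Z) →₀ ℕ, ∏ i, S i ^ (e i - 1) =
      S v ^ (e v - 1) * ∏ i ∈ Finset.univ.erase v, S i ^ (e i - 1) := fun e =>
    (Finset.mul_prod_erase _ _ (Finset.mem_univ v)).symm
  have hrest : ∏ i ∈ Finset.univ.erase v, S i ^ ((d + Finsupp.single v 1 : (Y ⊕ Z) →₀ ℕ) i - 1) =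
      ∏ i ∈ Finset.univ.erase v, S i ^ (d i - 1) := by
    refine Finset.prod_congr rfl fun i hi => ?_
    simp [(Finset.ne_of_mem_erase hi).symm]
  unfold weight
  rw [hs, hprod (d + _), hrest, hprod d]
  by_cases hv : v ∈ T
  · rw [if_pos hv]
    by_cases hd : v ∈ d.support
    · have h1 : d.support ≠ T.erase v := fun h => by simp [h] at hd
      rw [if_neg h1, Finset.insert_eq_of_mem hd, add_zero]
      have h2 : d v ≠ 0 := by simpa using hd
      obtain ⟨n, hn⟩ := Nat.exists_eq_succ_of_ne_zero h2
      split_ifs <;> simp [hn, pow_succ]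
      ring
    · have h1 : d.support ≠ T := fun h => hd (h ▸ hv)
      have h2 : insert v d.support = T ↔ d.support = T.erase v := by
        constructor
        · rintro rfl; rw [Finset.erase_insert hd]
        · intro h; rw [h, Finset.insert_erase hv]
      have h3 : d v = 0 := by simpa using hd
      simp only [h2, if_neg h1, mul_zero, zero_add]
      simp [h3]
  · rw [if_neg hv, if_neg]
    rintro rfl
    simp at hv

lemma weightFunctional_mul_monomial_single (S : Y ⊕ Z → F) (T : Finset (Y ⊕ Z)) (v : Y ⊕ Z) (c : F)
    (f : MvPolynomial (Y ⊕ Z) F) :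
    weightFunctional S T (f * MvPolynomial.monomial (Finsupp.single v 1) c) =
      if v ∈ T then c * (S v * weightFunctional S T f + weightFunctional S (T.erase v) f)
      else 0 := by
  induction f using MvPolynomial.induction_on' with
  | monomial d a =>
    rw [MvPolynomial.monomial_mul]
    simp only [weightFunctional_monomial, weight_add_single]
    split_ifs <;> ring
  | add f₁ f₂ h₁ h₂ =>
    rw [add_mul, map_add, h₁, h₂]
    split_ifs
    · simp only [map_add]; ring
    · simp

lemma eval_coeffMatrix (S : Y ⊕ Z → F) (f : MvPolynomial (Y ⊕ Z) F) (p : Finset Y) (q : Finset Z) :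
    MvPolynomial.eval S (coeffMatrix f p q) = weightFunctional S (vars p q) f := by
  conv_rhs => rw [← MvPolynomial.support_sum_monomial_coeff f]
  rw [coeffMatrix, map_sum, map_sum]
  refine Finset.sum_congr rfl fun d _ => ?_
  rw [weightFunctional_monomial]
  have hiff : (d.support ⊆ p.image Sum.inl ∪ q.image Sum.inr ∧ mexp p q ≤ d) ↔
      d.support = vars p q := by
    change (d.support ⊆ vars p q ∧ _) ↔ _
    rw [Finset.Subset.antisymm_iff]
    refine and_congr_right fun _ => ⟨fun h i hi => ?_, fun h i => ?_⟩
    · have := h i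
      rw [mexp_apply, if_pos hi] at this
      simp; omega
    · rw [mexp_apply]
      split_ifs with hi
      · have := h hi
        simp at this; omega
      · exact Nat.zero_le _
  simp only [hiff, weight]
  split_ifs with h
  · rw [MvPolynomial.eval_monomial, Finsupp.prod_fintype _ _ (by simp)]
    congr 1
    refine Finset.prod_congr rfl fun i _ => ?_
    rw [Finsupp.tsub_apply, mexp_apply, ← h]
    split_ifs with hi
    · rfl
    · have : d i = 0 := by simpa using hi
      simp [this]
  · simp

lemma evalMatrix_apply (S : Y ⊕ Z → F) (f : MvPolynomial (Y ⊕ Z) F) (p : Finset Y)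
    (q : Finset Z) : evalMatrix S f p q = weightFunctional S (vars p q) f :=
  eval_coeffMatrix S f p q

lemma evalMatrix_add (S : Y ⊕ Z → F) (f g : MvPolynomial (Y ⊕ Z) F) :
    evalMatrix S (f + g) = evalMatrix S f + evalMatrix S g := by
  ext p q
  simp [evalMatrix_apply]

lemma exists_evalMatrix_mul_monomial (S : Y ⊕ Z → F) (d : (Y ⊕ Z) →₀ ℕ) (c : F)
    (hd : (d.sum fun _ e => e) ≤ 1) :
    ∃ (A : Matrix (Finset Y) (Finset Y) F) (B : Matrix (Finset Z) (Finset Z) F), ∀ f,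
      evalMatrix S (f * MvPolynomial.monomial d c) = A * evalMatrix S f + evalMatrix S f * B := by
  rcases Nat.le_one_iff_eq_zero_or_eq_one.mp hd with h | h
  · obtain rfl : d = 0 := by
      rw [← Finsupp.degree_eq_zero_iff]
      exact h
    refine ⟨c • 1, 0, fun f => ?_⟩
    ext p q
    rw [mul_comm, ← MvPolynomial.C_apply, ← MvPolynomial.smul_eq_C_mul]
    simp [evalMatrix_apply]
  · obtain ⟨v, rfl⟩ := (Finsupp.sum_eq_one_iff d).mp h
    rcases v with y | z
    · refine ⟨Matrix.of fun p p' => if y ∈ p then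
        c * (S (Sum.inl y) * (if p' = p then 1 else 0) + if p' = p.erase y then 1 else 0) else 0,
        0, fun f => ?_⟩
      ext p q
      have hm : Sum.inl y ∈ vars p q ↔ y ∈ p := by simp [vars]
      simp only [evalMatrix_apply, weightFunctional_mul_monomial_single, vars_erase_inl, hm,
        Matrix.mul_zero, add_zero, Matrix.mul_apply, Matrix.of_apply]
      split_ifs
      · simp [mul_add, add_mul, Finset.sum_add_distrib]
        ring
      · simp
    · refine ⟨0, Matrix.of fun q' q => if z ∈ q then
        c * (S (Sum.inr z) * (if q' = q then 1 else 0) + if q' = q.erase z then 1 else 0) else 0,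
        fun f => ?_⟩
      ext p q
      have hm : Sum.inr z ∈ vars p q ↔ z ∈ q := by simp [vars]
      simp only [evalMatrix_apply, weightFunctional_mul_monomial_single, vars_erase_inr, hm,
        Matrix.zero_mul, zero_add, Matrix.mul_apply, Matrix.of_apply]
      split_ifs
      · simp [mul_add, Finset.sum_add_distrib]
        ring
      · simp

lemma exists_evalMatrix_mul_affine (S : Y ⊕ Z → F) (g : MvPolynomial (Y ⊕ Z) F)
    (hg : g.totalDegree ≤ 1) :
    ∃ (A : Matrix (Finset Y) (Finset Y) F) (B : Matrix (Finset Z) (Finset Z) F), ∀ f,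
      evalMatrix S (f * g) = A * evalMatrix S f + evalMatrix S f * B := by
  rw [← MvPolynomial.support_sum_monomial_coeff g]
  refine Finset.sum_induction _ (fun g => ∃ (A : Matrix (Finset Y) (Finset Y) F)
    (B : Matrix (Finset Z) (Finset Z) F), ∀ f,
      evalMatrix S (f * g) = A * evalMatrix S f + evalMatrix S f * B) ?_ ?_ ?_
  · rintro g₁ g₂ ⟨A₁, B₁, h₁⟩ ⟨A₂, B₂, h₂⟩
    refine ⟨A₁ + A₂, B₁ + B₂, fun f => ?_⟩
    rw [mul_add, evalMatrix_add, h₁, h₂, Matrix.add_mul, Matrix.mul_add]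
    abel
  · refine ⟨0, 0, fun f => ?_⟩
    ext p q
    simp [evalMatrix_apply]
  · intro d hd
    exact exists_evalMatrix_mul_monomial S d _ ((MvPolynomial.le_totalDegree hd).trans hg)

end PCM

/-- if `g` is an affine form (total degree at most 1), then
`maxrank(M_{fg}) ≤ 2 · maxrank(M_f)`. -/
theorem maxrank_mul_affine_le {F : Type} [Field F] {Y Z : Type} [Fintype Y] [Fintype Z]
    (f g : MvPolynomial (Y ⊕ Z) F) (hg : g.totalDegree ≤ 1) :
    PCM.maxrank (f * g) ≤ 2 * PCM.maxrank f := by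
  refine ciSup_le fun S => ?_
  obtain ⟨A, B, h⟩ := PCM.exists_evalMatrix_mul_affine S g hg
  change (PCM.evalMatrix S (f * g)).rank ≤ _
  rw [h f]
  have h₁ := PCM.rank_add_le (A * PCM.evalMatrix S f) (PCM.evalMatrix S f * B)
  have h₂ := Matrix.rank_mul_le_right A (PCM.evalMatrix S f)
  have h₃ := Matrix.rank_mul_le_left (PCM.evalMatrix S f) B
  have h₄ := PCM.rank_evalMatrix_le_maxrank S f
  omega
end
end

section
/- Let f be the iterated matrix multiplication polynomial, i.e., the (1,1) entry of A^1 A^2 ⋯ A^d, and let B be the partition sending all variables of odd-indexed matrices to Y-variables and all variables of even-indexed matrices to Z-variables. Then maxrank(M_{f^B}) = n^{d−1}; equivalently, since f^B is multilinear, the partial derivatives matrix L_{f^B} has rank exactly n^{d−1}. -/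
open scoped Classical

noncomputable section

namespace IMM

/-- Indices of the odd-numbered matrices `A^1, A^3, …` (0-based even), together with a
position in an `n × n` matrix: the `Y`-variables of the partition `B`. -/
abbrev OddV (n d : ℕ) := {i : Fin d // i.val % 2 = 0} × Fin n × Fin n

/-- Indices of the even-numbered matrices `A^2, A^4, …` (0-based odd), together with a
position in an `n × n` matrix: the `Z`-variables of the partition `B`. -/
abbrev EvenV (n d : ℕ) := {i : Fin d // i.val % 2 = 1} × Fin n × Fin n

/-- The matrix `A^{i+1}` of distinct variables, with variables of odd-numbered matrices
renamed (by the partition `B`) to `Y`-variables and those of even-numbered matrices to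
`Z`-variables. -/
noncomputable def matB (F : Type) [Field F] (n d : ℕ) (i : Fin d) :
    Matrix (Fin n) (Fin n) (MvPolynomial (OddV n d ⊕ EvenV n d) F) := fun j k =>
  if h : i.val % 2 = 0 then MvPolynomial.X (Sum.inl (⟨i, h⟩, j, k))
  else MvPolynomial.X
    (Sum.inr (⟨i, (Nat.mod_two_eq_zero_or_one i.val).resolve_left h⟩, j, k))

/-- The `(j,k)` entry of the product `A^1 A^2 ⋯ A^d`, after the renaming `B`. -/
noncomputable def imm (F : Type) [Field F] (n d : ℕ) (j k : Fin n) :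
    MvPolynomial (OddV n d ⊕ EvenV n d) F :=
  (List.ofFn (matB F n d)).prod j k

end IMM

namespace PCM

variable {F : Type} [Field F] {Y Z : Type}

lemma mexp_inl (p : Finset Y) (q : Finset Z) (y : Y) :
    mexp p q (Sum.inl y) = if y ∈ p then 1 else 0 := by
  simp [mexp, Finsupp.single_apply]

lemma mexp_inr (p : Finset Y) (q : Finset Z) (z : Z) :
    mexp p q (Sum.inr z) = if z ∈ q then 1 else 0 := by
  simp [mexp, Finsupp.single_apply]

lemma mexp_le_one (p : Finset Y) (q : Finset Z) (x : Y ⊕ Z) : mexp p q x ≤ 1 := by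
  cases x <;> simp only [mexp_inl, mexp_inr] <;> split_ifs <;> simp

lemma mexp_inj {p p' : Finset Y} {q q' : Finset Z} :
    mexp p q = mexp p' q' ↔ p = p' ∧ q = q' := by
  refine ⟨fun h => ⟨?_, ?_⟩, fun ⟨hp, hq⟩ => by rw [hp, hq]⟩
  · ext y
    have := DFunLike.congr_fun h (Sum.inl y)
    simp only [mexp_inl] at this
    split_ifs at this <;> simp_all
  · ext z
    have := DFunLike.congr_fun h (Sum.inr z)
    simp only [mexp_inr] at this
    split_ifs at this <;> simp_all

lemma support_subset_and_mexp_le_iff (p : Finset Y) (q : Finset Z) {e : (Y ⊕ Z) →₀ ℕ}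
    (he : ∀ x, e x ≤ 1) :
    (e.support ⊆ p.image Sum.inl ∪ q.image Sum.inr ∧ mexp p q ≤ e) ↔ e = mexp p q := by
  constructor
  · rintro ⟨hs, hle⟩
    refine le_antisymm (fun x => ?_) hle
    by_cases hx : e x = 0
    · simp [hx]
    · have hmem := hs (Finsupp.mem_support_iff.2 hx)
      refine (he x).trans ?_
      rcases x with y | z
      · rw [mexp_inl, if_pos (by simpa using hmem)]
      · rw [mexp_inr, if_pos (by simpa using hmem)]
  · rintro rfl
    refine ⟨fun x hx => ?_, le_rfl⟩
    rw [Finsupp.mem_support_iff] at hx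
    rcases x with y | z
    · simpa [mexp_inl] using hx
    · simpa [mexp_inr] using hx

/-- For a multilinear polynomial, the polynomial coefficient matrix is the partial derivatives
matrix, with constant entries. -/
lemma coeffMatrix_eq_of_multilinear (f : MvPolynomial (Y ⊕ Z) F)
    (hf : ∀ e ∈ f.support, ∀ x, e x ≤ 1) :
    coeffMatrix f = (pdMatrix f).map MvPolynomial.C := by
  ext1 p q
  have h : coeffMatrix f p q = ∑ e ∈ f.support,
      if e = mexp p q then MvPolynomial.C (MvPolynomial.coeff (mexp p q) f) else 0 := by
    refine Finset.sum_congr rfl fun e he => ?_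
    by_cases hep : e = mexp p q
    · rw [if_pos ((support_subset_and_mexp_le_iff p q (hf e he)).2 hep), if_pos hep, hep,
        tsub_self]
      rfl
    · rw [if_neg (mt (support_subset_and_mexp_le_iff p q (hf e he)).1 hep), if_neg hep]
  rw [h, Finset.sum_ite_eq']
  split_ifs with hmem
  · rfl
  · simp [pdMatrix, MvPolynomial.notMem_support_iff.1 hmem]

lemma maxrank_eq_rank_pdMatrix [Fintype Y] [Fintype Z] (f : MvPolynomial (Y ⊕ Z) F)
    (hf : ∀ e ∈ f.support, ∀ x, e x ≤ 1) :
    maxrank f = (pdMatrix f).rank := by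
  have h : ∀ S : (Y ⊕ Z) → F,
      (coeffMatrix f).map (MvPolynomial.eval S) = pdMatrix f := fun S => by
    ext p q
    simp [coeffMatrix_eq_of_multilinear f hf]
  simp only [maxrank, h, ciSup_const]

/-- A sum of monomials indexed by `W`, in which distinct indices have distinct `Y`-parts and
distinct `Z`-parts, has maxrank `|W|`. -/
lemma maxrank_sum_monomial_mexp [Fintype Y] [Fintype Z] {W : Type} [Fintype W]
    (P : W → Finset Y) (Q : W → Finset Z) (hP : P.Injective) (hQ : Q.Injective) :
    maxrank (∑ w, MvPolynomial.monomial (mexp (P w) (Q w)) (1 : F)) = Fintype.card W := by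
  rw [maxrank_eq_rank_pdMatrix]
  · let U : Matrix (Finset Y) W F := .of fun p w => if P w = p then 1 else 0
    let V : Matrix W (Finset Z) F := .of fun w q => if Q w = q then 1 else 0
    have hL : pdMatrix (∑ w, MvPolynomial.monomial (mexp (P w) (Q w)) (1 : F)) = U * V := by
      ext p q
      simp only [pdMatrix, MvPolynomial.coeff_sum, MvPolynomial.coeff_monomial, mexp_inj,
        Matrix.mul_apply, Matrix.of_apply, U, V, ← ite_and, mul_ite, mul_one, mul_zero]
      simp only [and_comm]
    have hU : U.transpose * U = 1 := by
      ext w w'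
      simp [U, Matrix.mul_apply, Matrix.one_apply, hP.eq_iff, eq_comm]
    have hV : V * V.transpose = 1 := by
      ext w w'
      simp [V, Matrix.mul_apply, Matrix.one_apply, hQ.eq_iff, eq_comm]
    rw [hL]
    refine le_antisymm ((Matrix.rank_mul_le_left U V).trans (Matrix.rank_le_card_width U)) ?_
    calc Fintype.card W = (U.transpose * (U * V) * V.transpose).rank := by
          rw [← Matrix.mul_assoc, hU, Matrix.one_mul, hV, Matrix.rank_one]
      _ ≤ (U.transpose * (U * V)).rank := Matrix.rank_mul_le_left _ _
      _ ≤ (U * V).rank := Matrix.rank_mul_le_right _ _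
  · intro e he
    obtain ⟨w, -, hw⟩ := Finset.mem_biUnion.1 (MvPolynomial.support_sum he)
    rw [Finset.mem_singleton.1 (MvPolynomial.support_monomial_subset hw)]
    exact mexp_le_one _ _

lemma monomial_mexp (p : Finset Y) (q : Finset Z) :
    MvPolynomial.monomial (mexp p q) (1 : F) =
      (∏ y ∈ p, MvPolynomial.X (Sum.inl y)) * ∏ z ∈ q, MvPolynomial.X (Sum.inr z) := by
  have h : ∀ {ι : Type} (s : Finset ι) (g : ι → Y ⊕ Z),
      ∏ i ∈ s, MvPolynomial.X (R := F) (g i) =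
        MvPolynomial.monomial (∑ i ∈ s, Finsupp.single (g i) 1) 1 := fun s g =>
    (MvPolynomial.monomial_sum_one s fun i => Finsupp.single (g i) 1).symm
  rw [h, h, MvPolynomial.monomial_mul, one_mul, mexp]

end PCM

/-- An entry of a product of matrices is a sum over paths. -/
lemma Matrix.list_prod_ofFn_apply {R : Type*} [CommSemiring R] {m : Type*} [Fintype m]
    [DecidableEq m] {d : ℕ} (A : Fin d → Matrix m m R) (j k : m) :
    (List.ofFn A).prod j k = ∑ w : Fin (d + 1) → m,
      if w 0 = j ∧ w (Fin.last d) = k then ∏ i, A i (w i.castSucc) (w i.succ) else 0 := by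
  induction d generalizing j with
  | zero =>
    rw [← (Equiv.funUnique (Fin 1) m).symm.sum_comp]
    simp [Matrix.one_apply, ite_and]
  | succ d ih =>
    rw [List.ofFn_succ, List.prod_cons, Matrix.mul_apply,
      ← (Fin.consEquiv fun _ : Fin (d + 2) => m).sum_comp, Fintype.sum_prod_type]
    simp only [ih, Finset.mul_sum]
    rw [Finset.sum_comm, Finset.sum_comm (γ := m)]
    refine Finset.sum_congr rfl fun w _ => ?_
    simp [Fin.consEquiv, Fin.prod_univ_succ, ite_and, -Fin.succ_last]

namespace IMM

variable {n d : ℕ}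

/-- The closed paths of length `d` at `a` in the complete digraph on `Fin n`. -/
abbrev Path (n d : ℕ) (a : Fin n) :=
  {w : Fin (d + 1) → Fin n // w 0 = a ∧ w (Fin.last d) = a}

lemma card_path (a : Fin n) (hd : 2 ≤ d) : Fintype.card (Path n d a) = n ^ (d - 1) := by
  obtain ⟨m, rfl⟩ := Nat.exists_eq_add_of_le' hd
  have h : (Finset.univ.filter fun w : Fin (m + 3) → Fin n =>
      w 0 = a ∧ w (Fin.last (m + 2)) = a) =
      Fintype.piFinset fun j : Fin (m + 3) =>
        if j = 0 ∨ j = Fin.last (m + 2) then {a} else Finset.univ := by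
    ext w
    simp only [Finset.mem_filter, Finset.mem_univ, true_and, Fintype.mem_piFinset]
    constructor
    · rintro ⟨h0, hl⟩ j
      split_ifs with hj
      · rcases hj with rfl | rfl <;> simpa
      · simp
    · intro hw
      exact ⟨by simpa using hw 0, by simpa using hw (Fin.last _)⟩
  rw [Fintype.card_subtype, h, Fintype.card_piFinset, Fin.prod_univ_succ,
    Fin.prod_univ_castSucc]
  simp [-Fin.succ_last, Fin.succ_ne_zero, Fin.castSucc_ne_last]

/-- The `Y`-variables along a path. -/
def oddVars (w : Fin (d + 1) → Fin n) : Finset (OddV n d) :=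
  Finset.univ.image fun i => (i, w i.1.castSucc, w i.1.succ)

/-- The `Z`-variables along a path. -/
def evenVars (w : Fin (d + 1) → Fin n) : Finset (EvenV n d) :=
  Finset.univ.image fun i => (i, w i.1.castSucc, w i.1.succ)

lemma agree_of_oddVars_eq {w w' : Fin (d + 1) → Fin n} (h : oddVars w = oddVars w')
    (i : Fin d) (hi : i.val % 2 = 0) :
    w i.castSucc = w' i.castSucc ∧ w i.succ = w' i.succ := by
  have hmem : ((⟨i, hi⟩, w i.castSucc, w i.succ) : OddV n d) ∈ oddVars w' :=
    h ▸ Finset.mem_image.2 ⟨⟨i, hi⟩, Finset.mem_univ _, rfl⟩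
  obtain ⟨i', -, hi'⟩ := Finset.mem_image.1 hmem
  simp only [Prod.mk.injEq] at hi'
  obtain ⟨rfl, h1, h2⟩ := hi'
  exact ⟨h1.symm, h2.symm⟩

lemma agree_of_evenVars_eq {w w' : Fin (d + 1) → Fin n} (h : evenVars w = evenVars w')
    (i : Fin d) (hi : i.val % 2 = 1) :
    w i.castSucc = w' i.castSucc ∧ w i.succ = w' i.succ := by
  have hmem : ((⟨i, hi⟩, w i.castSucc, w i.succ) : EvenV n d) ∈ evenVars w' :=
    h ▸ Finset.mem_image.2 ⟨⟨i, hi⟩, Finset.mem_univ _, rfl⟩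
  obtain ⟨i', -, hi'⟩ := Finset.mem_image.1 hmem
  simp only [Prod.mk.injEq] at hi'
  obtain ⟨rfl, h1, h2⟩ := hi'
  exact ⟨h1.symm, h2.symm⟩

/-- Paths with common endpoints that agree along every step of one fixed parity are equal. -/
lemma path_ext {a : Fin n} {w w' : Path n d a} (r : ℕ) (hr : r < 2)
    (h : ∀ i : Fin d, i.val % 2 = r →
      w.1 i.castSucc = w'.1 i.castSucc ∧ w.1 i.succ = w'.1 i.succ) : w = w' := by
  refine Subtype.ext (funext fun j => ?_)
  by_cases hj : j.val % 2 = r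
  · induction j using Fin.lastCases with
    | last => rw [w.2.2, w'.2.2]
    | cast i => exact (h i hj).1
  · induction j using Fin.cases with
    | zero => rw [w.2.1, w'.2.1]
    | succ i =>
      rw [Fin.val_succ] at hj
      exact (h i (by omega)).2

lemma prod_matB (F : Type) [Field F] (w : Fin (d + 1) → Fin n) :
    ∏ i, matB F n d i (w i.castSucc) (w i.succ) =
      MvPolynomial.monomial (PCM.mexp (oddVars w) (evenVars w)) 1 := by
  rw [PCM.monomial_mexp, oddVars, evenVars,
    Finset.prod_image fun i _ i' _ h => (Prod.ext_iff.1 h).1,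
    Finset.prod_image fun i _ i' _ h => (Prod.ext_iff.1 h).1,
    ← Fintype.prod_subtype_mul_prod_subtype fun i : Fin d => i.val % 2 = 0]
  congr 1
  · refine Finset.prod_congr (by congr) fun i _ => ?_
    rw [matB, dif_pos i.2]
  · refine Fintype.prod_equiv (Equiv.subtypeEquivRight fun i => Nat.mod_two_ne_zero) _ _
      fun i => ?_
    rw [matB, dif_neg i.2]
    rfl

lemma imm_eq_sum_path (F : Type) [Field F] (a : Fin n) :
    imm F n d a a = ∑ w : Path n d a,
      MvPolynomial.monomial (PCM.mexp (oddVars w.1) (evenVars w.1)) 1 := by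
  simp only [imm, Matrix.list_prod_ofFn_apply, prod_matB]
  rw [← Finset.sum_filter]
  exact Finset.sum_subtype _ (by simp) _

end IMM

/-- for the `(1,1)` entry `f` of `A^1 A^2 ⋯ A^d` and the partition `B`
sending variables of odd-numbered matrices to `Y` and those of even-numbered matrices
to `Z`, `maxrank(M_{f^B}) = n^{d-1}`. -/
theorem maxrank_imm {F : Type} [Field F] (n d : ℕ) (hn : 0 < n) (hd : 2 ≤ d) :
    PCM.maxrank (IMM.imm F n d ⟨0, hn⟩ ⟨0, hn⟩) = n ^ (d - 1) := by
  rw [IMM.imm_eq_sum_path, PCM.maxrank_sum_monomial_mexp, IMM.card_path _ hd]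
  · exact fun w w' h => IMM.path_ext 0 (by norm_num) (IMM.agree_of_oddVars_eq h)
  · exact fun w w' h => IMM.path_ext 1 (by norm_num) (IMM.agree_of_evenVars_eq h)
end
end
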